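/- Let g̃, h̃ : [0,∞) → [0,∞) with ∫₀^∞ h̃ = 1, ‖g̃‖₁ < ∞, and 0 ≤ B̃ < 1. Then for all t ≥ 0, ∫_t^∞ Σ_{n=0}^∞ B̃ⁿ (g̃∗h̃^{∗n})(s) ds ≤ (1/(1−B̃)) ∫_{t/2}^∞ g̃(s) ds + ‖g̃‖₁ Σ_{n=1}^∞ B̃ⁿ n ∫_{t/(2n)}^∞ h̃(s) ds. -/

import Mathlib

open MeasureTheory

/-- Convolution of two functions on `[0,∞)`. -/
noncomputable def convPos (u v : ℝ → ℝ) : ℝ → ℝ := fun t => ∫ s in (0:ℝ)..t, u s * v (t - s)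

/-- `convIter g h n = g ∗ h^{∗n}`. -/
noncomputable def convIter (g h : ℝ → ℝ) : ℕ → ℝ → ℝ
  | 0 => g
  | (n + 1) => convPos (convIter g h n) h

/-- Iterated convolution in `ℝ≥0∞`. -/
noncomputable def eIter (G H : ℝ → ENNReal) : ℕ → ℝ → ENNReal
  | 0 => G
  | (n + 1) => fun t => ∫⁻ s, eIter G H n s * H (t - s)

lemma eIter_meas (G H : ℝ → ENNReal) (hG : Measurable G) (hH : Measurable H) (n : ℕ) :
    Measurable (eIter G H n) := by
  induction n with
  | zero => exact hG
  | succ n ih =>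
    have : Measurable (fun p : ℝ × ℝ => eIter G H n p.2 * H (p.1 - p.2)) := by fun_prop
    exact this.lintegral_prod_right'

lemma conv_tail_eq (u v : ℝ → ENNReal) (hu : Measurable u) (hv : Measurable v)
    (S : Set ℝ) (hS : MeasurableSet S) :
    ∫⁻ t in S, ∫⁻ s, u s * v (t - s) = ∫⁻ s, ∫⁻ y, S.indicator 1 (y + s) * (u s * v y) := by
  rw [← lintegral_indicator hS]
  have h1 : ∀ t, S.indicator (fun t => ∫⁻ s, u s * v (t - s)) t
      = ∫⁻ s, S.indicator 1 t * (u s * v (t - s)) := by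
    intro t
    by_cases ht : t ∈ S <;> simp [ht]
  simp_rw [h1]
  have hm : Measurable (S.indicator (1 : ℝ → ENNReal)) := measurable_one.indicator hS
  rw [lintegral_lintegral_swap]
  · refine lintegral_congr fun s => ?_
    rw [← lintegral_add_right_eq_self _ s]
    simp
  · apply Measurable.aemeasurable
    unfold Function.uncurry
    fun_prop

lemma conv_total (u v : ℝ → ENNReal) (hu : Measurable u) (hv : Measurable v) :
    ∫⁻ t, ∫⁻ s, u s * v (t - s) = (∫⁻ s, u s) * ∫⁻ y, v y := by
  have := conv_tail_eq u v hu hv Set.univ MeasurableSet.univ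
  simp only [Measure.restrict_univ, Set.indicator_univ, Pi.one_apply, one_mul] at this
  rw [this]
  simp_rw [lintegral_const_mul _ hv]
  rw [lintegral_mul_const _ hu]

lemma conv_tail (u v : ℝ → ENNReal) (hu : Measurable u) (hv : Measurable v) (a b : ℝ) :
    ∫⁻ t in Set.Ioi (a + b), ∫⁻ s, u s * v (t - s) ≤
      (∫⁻ s in Set.Ioi a, u s) * (∫⁻ y, v y) + (∫⁻ s, u s) * ∫⁻ y in Set.Ioi b, v y := by
  rw [conv_tail_eq u v hu hv _ measurableSet_Ioi]
  have hu' : Measurable ((Set.Ioi a).indicator u) := hu.indicator measurableSet_Ioi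
  have hv' : Measurable ((Set.Ioi b).indicator v) := hv.indicator measurableSet_Ioi
  calc _ ≤ ∫⁻ s, ∫⁻ y, ((Set.Ioi a).indicator u s * v y + u s * (Set.Ioi b).indicator v y) := by
        refine lintegral_mono fun s => lintegral_mono fun y => ?_
        by_cases h1 : a < s
        · by_cases h3 : a + b < y + s <;> simp [Set.indicator, h1, h3]
        · by_cases h2 : b < y
          · by_cases h3 : a + b < y + s <;> simp [Set.indicator, h1, h2, h3]
          · have h3 : ¬ (a + b < y + s) := by linarith
            simp [Set.indicator, h3]
    _ = _ := by
        have : ∀ s, ∫⁻ y, ((Set.Ioi a).indicator u s * v y + u s * (Set.Ioi b).indicator v y)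
            = (Set.Ioi a).indicator u s * (∫⁻ y, v y) + u s * ∫⁻ y in Set.Ioi b, v y := by
          intro s
          rw [lintegral_add_left (by fun_prop), lintegral_const_mul _ hv,
            lintegral_const_mul _ hv', lintegral_indicator measurableSet_Ioi]
        simp_rw [this]
        rw [lintegral_add_left (by fun_prop), lintegral_mul_const _ hu',
          lintegral_mul_const _ hu, lintegral_indicator measurableSet_Ioi]

lemma eIter_total (G H : ℝ → ENNReal) (hG : Measurable G) (hH : Measurable H)
    (h1 : ∫⁻ y, H y = 1) (n : ℕ) : ∫⁻ s, eIter G H n s = ∫⁻ s, G s := by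
  induction n with
  | zero => rfl
  | succ n ih =>
    have := conv_total _ _ (eIter_meas G H hG hH n) hH
    rw [h1, mul_one, ih] at this
    exact this

lemma eIter_tail (G H : ℝ → ENNReal) (hG : Measurable G) (hH : Measurable H)
    (h1 : ∫⁻ y, H y = 1) (a b : ℝ) (n : ℕ) :
    ∫⁻ s in Set.Ioi (a + n * b), eIter G H n s ≤
      (∫⁻ s in Set.Ioi a, G s) + n * ((∫⁻ s, G s) * ∫⁻ s in Set.Ioi b, H s) := by
  induction n with
  | zero => simp [eIter]
  | succ n ih =>
    have := conv_tail _ _ (eIter_meas G H hG hH n) hH (a + n * b) b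
    rw [h1, mul_one, eIter_total G H hG hH h1] at this
    have e : a + ((n + 1 : ℕ) : ℝ) * b = a + n * b + b := by push_cast; ring
    rw [e]
    refine this.trans ((add_le_add_left ih _).trans (le_of_eq ?_))
    push_cast
    ring

/-- `ℝ≥0∞` version of a function on `[0,∞)`. -/
noncomputable def ePos (g : ℝ → ℝ) : ℝ → ENNReal := (Set.Ici 0).indicator fun s => ‖g s‖ₑ

lemma ePos_meas (g : ℝ → ℝ) (hg : Measurable g) : Measurable (ePos g) :=
  hg.enorm.indicator measurableSet_Ici

lemma convIter_le (g h : ℝ → ℝ) (n : ℕ) :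
    ∀ s, 0 ≤ s → ‖convIter g h n s‖ₑ ≤ eIter (ePos g) (ePos h) n s := by
  induction n with
  | zero => intro s hs; simp [convIter, eIter, ePos, hs]
  | succ n ih =>
    intro s hs
    simp only [convIter, eIter, convPos]
    rw [intervalIntegral.integral_of_le hs]
    refine (enorm_integral_le_lintegral_enorm _).trans ?_
    refine le_trans ?_ (setLIntegral_le_lintegral (Set.Ioc 0 s) _)
    refine setLIntegral_mono' measurableSet_Ioc fun x hx => ?_
    rw [enorm_mul]
    refine mul_le_mul' (ih x hx.1.le) ?_
    have : 0 ≤ s - x := by linarith [hx.2]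
    simp [ePos, hx.2]

lemma ePos_tail (g : ℝ → ℝ) (hgnn : ∀ t, 0 ≤ g t)
    (hgint : IntegrableOn g (Set.Ioi 0)) (a : ℝ) (ha : 0 ≤ a) :
    ∫⁻ s in Set.Ioi a, ePos g s = ENNReal.ofReal (∫ s in Set.Ioi a, g s) := by
  rw [ofReal_integral_eq_lintegral_ofReal (hgint.mono_set (Set.Ioi_subset_Ioi ha))
    (Filter.Eventually.of_forall hgnn)]
  refine setLIntegral_congr_fun measurableSet_Ioi fun x hx => ?_
  have : 0 ≤ x := ha.trans (le_of_lt hx)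
  simp [ePos, this, Real.enorm_of_nonneg (hgnn x)]

lemma ePos_total (g : ℝ → ℝ) (hgnn : ∀ t, 0 ≤ g t)
    (hgint : IntegrableOn g (Set.Ioi 0)) :
    ∫⁻ s, ePos g s = ENNReal.ofReal (∫ s in Set.Ioi 0, g s) := by
  rw [← ePos_tail g hgnn hgint 0 le_rfl]
  unfold ePos
  rw [lintegral_indicator measurableSet_Ici, setLIntegral_congr Ioi_ae_eq_Ici.symm]
  refine setLIntegral_congr_fun measurableSet_Ioi fun x hx => ?_
  simp [le_of_lt (Set.mem_Ioi.1 hx)]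

lemma enorm_tsum_le' (f : ℕ → ℝ) : ‖∑' n, f n‖ₑ ≤ ∑' n, ‖f n‖ₑ := by
  by_cases hf : Summable f
  · refine le_of_tendsto (hf.hasSum.tendsto_sum_nat.enorm) (Filter.Eventually.of_forall fun n => ?_)
    exact (enorm_sum_le _ _).trans (ENNReal.sum_le_tsum _)
  · simp [tsum_eq_zero_of_not_summable hf]

/-- Tail estimate for the resolvent series: for nonnegative `g̃, h̃` with `∫₀^∞ h̃ = 1`,
`‖g̃‖₁ < ∞` and `0 ≤ B̃ < 1`, for all `t ≥ 0`,
`∫_t^∞ Σₙ B̃ⁿ (g̃∗h̃^{∗n})(s) ds ≤ (1/(1−B̃)) ∫_{t/2}^∞ g̃ + ‖g̃‖₁ Σ_{n≥1} B̃ⁿ n ∫_{t/(2n)}^∞ h̃`. -/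
theorem resolvent_series_tail_estimate
    (g h : ℝ → ℝ) (B : ℝ) (hB0 : 0 ≤ B) (hB1 : B < 1)
    (hgm : Measurable g) (hhm : Measurable h)
    (hgnn : ∀ t, 0 ≤ g t) (hhnn : ∀ t, 0 ≤ h t)
    (hgint : IntegrableOn g (Set.Ioi 0)) (hhint : IntegrableOn h (Set.Ioi 0))
    (hnorm : ∫ t in Set.Ioi (0:ℝ), h t = 1) :
    ∀ t : ℝ, 0 ≤ t →
      (∫ s in Set.Ioi t, ∑' n : ℕ, B ^ n * convIter g h n s)
        ≤ (1 / (1 - B)) * (∫ s in Set.Ioi (t / 2), g s)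
          + (∫ s in Set.Ioi (0:ℝ), g s) *
              ∑' n : ℕ, B ^ (n + 1) * (n + 1) * ∫ s in Set.Ioi (t / (2 * (n + 1))), h s := by
  intro t ht
  set A := ∫ s in Set.Ioi (t / 2), g s with hA
  set N := ∫ s in Set.Ioi (0:ℝ), g s with hN
  set c : ℕ → ℝ := fun n => ∫ s in Set.Ioi (t / (2 * (n : ℝ))), h s with hc
  have hA0 : 0 ≤ A := integral_nonneg hgnn
  have hN0 : 0 ≤ N := integral_nonneg hgnn
  have hc0 : ∀ n, 0 ≤ c n := fun n => integral_nonneg hhnn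
  have hc1 : ∀ n, c n ≤ 1 := fun n => by
    rw [← hnorm]
    exact setIntegral_mono_set hhint (Filter.Eventually.of_forall hhnn)
      (Set.Ioi_subset_Ioi (by positivity)).eventuallyLE
  have hH1 : ∫⁻ y, ePos h y = 1 := by rw [ePos_total h hhnn hhint, hnorm]; simp
  -- tail of each iterate
  have key : ∀ n : ℕ, ∫⁻ s in Set.Ioi t, eIter (ePos g) (ePos h) n s
      ≤ ENNReal.ofReal (A + n * (N * c n)) := by
    intro n
    have h2 := eIter_tail (ePos g) (ePos h) (ePos_meas g hgm) (ePos_meas h hhm) hH1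
      (t / 2) (t / (2 * n)) n
    rw [ePos_tail g hgnn hgint _ (by positivity), ePos_tail h hhnn hhint _ (by positivity),
      ePos_total g hgnn hgint] at h2
    rw [ENNReal.ofReal_add hA0 (by have := hc0 n; positivity), ENNReal.ofReal_mul (by positivity),
      ENNReal.ofReal_mul hN0, ENNReal.ofReal_natCast]
    refine le_trans (lintegral_mono_set (Set.Ioi_subset_Ioi ?_)) h2
    rcases Nat.eq_zero_or_pos n with rfl | hn
    · simp; linarith
    · have : (n : ℝ) ≠ 0 := by positivity
      apply le_of_eq
      field_simp
      ring
  -- summability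
  have hs1 : Summable fun n : ℕ => B ^ n * A := (summable_geometric_of_lt_one hB0 hB1).mul_right A
  have hs0 : Summable fun n : ℕ => (n : ℝ) * B ^ n := by
    have := summable_pow_mul_geometric_of_norm_lt_one (R := ℝ) 1 (r := B)
      (by rwa [Real.norm_of_nonneg hB0])
    simpa using this
  have hs2 : Summable fun n : ℕ => B ^ n * n * c n := by
    refine Summable.of_nonneg_of_le (fun n => by have := hc0 n; positivity) (fun n => ?_) hs0
    have : 0 ≤ B ^ n * n := by positivity
    nlinarith [hc1 n]
  have hs3 : Summable fun n : ℕ => N * (B ^ n * n * c n) := hs2.mul_left N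
  have hR : (1 / (1 - B)) * A + N * ∑' n : ℕ, B ^ (n + 1) * (n + 1) *
      (∫ s in Set.Ioi (t / (2 * ((n : ℝ) + 1))), h s) = ∑' n : ℕ, B ^ n * (A + n * (N * c n)) := by
    have e : ∀ n : ℕ, B ^ n * (A + n * (N * c n)) = B ^ n * A + N * (B ^ n * n * c n) := by
      intro n; ring
    simp_rw [e]
    rw [hs1.tsum_add hs3, tsum_mul_right, tsum_geometric_of_lt_one hB0 hB1, tsum_mul_left,
      hs2.tsum_eq_zero_add]
    simp [hc]
  have hsum : Summable fun n : ℕ => B ^ n * (A + n * (N * c n)) := by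
    refine (hs1.add hs3).congr fun n => ?_
    ring
  have hpos : ∀ n : ℕ, 0 ≤ B ^ n * (A + n * (N * c n)) := fun n => by
    have := hc0 n; positivity
  rw [hR]
  refine (le_abs_self _).trans ?_
  rw [← Real.norm_eq_abs, ← ENNReal.ofReal_le_ofReal_iff (tsum_nonneg hpos), ofReal_norm,
    ENNReal.ofReal_tsum_of_nonneg hpos hsum]
  refine (enorm_integral_le_lintegral_enorm _).trans ?_
  calc _ ≤ ∫⁻ s in Set.Ioi t, ∑' n : ℕ, ENNReal.ofReal (B ^ n) * eIter (ePos g) (ePos h) n s := by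
        refine setLIntegral_mono' measurableSet_Ioi fun x hx => ?_
        refine (enorm_tsum_le' _).trans (ENNReal.tsum_le_tsum fun n => ?_)
        rw [enorm_mul, Real.enorm_of_nonneg (by positivity)]
        exact mul_le_mul_right (convIter_le g h n x (ht.trans (le_of_lt hx))) _
    _ = ∑' n : ℕ, ENNReal.ofReal (B ^ n) * ∫⁻ s in Set.Ioi t, eIter (ePos g) (ePos h) n s := by
        have hm := eIter_meas (ePos g) (ePos h) (ePos_meas g hgm) (ePos_meas h hhm)
        rw [lintegral_tsum fun n => ((hm n).const_mul _).aemeasurable]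
        exact tsum_congr fun n => lintegral_const_mul _ (hm n)
    _ ≤ _ := by
        refine ENNReal.tsum_le_tsum fun n => ?_
        rw [ENNReal.ofReal_mul (by positivity)]
        exact mul_le_mul_right (key n) _
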